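/- Let α be irrational, n ≥ 1, and x, y ∈ T with ‖x − y‖ ≤ λ^{(n)} and such that x + jα ≠ 0 and y + jα ≠ 0 for all 0 ≤ j < q_n. Identify points of T with their representatives in [0,1) and set ψ₁(t) = 1/t for t ∈ (0,1). Let j₀ and j₁ be indices in {0,…,q_n−1} maximizing j ↦ ψ₁(x + jα) and j ↦ ψ₁(y + jα) respectively. Then |Σ_{j=0}^{q_n−1} ψ₁(x + jα) − Σ_{j=0}^{q_n−1} ψ₁(y + jα)| ≤ |ψ₁(x + j₀α) − ψ₁(y + j₀α)| + |ψ₁(x + j₁α) − ψ₁(y + j₁α)| + λ^{(n)} q_n / λ^{(n−1)}. -/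

import Mathlib

/-- The complete quotients of the continued fraction expansion of `α`
(`cfQuot α 0 = α`, and `cfQuot α (n+1)` is the inverse of the fractional part
of `cfQuot α n`). -/
noncomputable def cfQuot (α : ℝ) : ℕ → ℝ
  | 0 => α
  | n + 1 => (cfQuot α n - ⌊cfQuot α n⌋)⁻¹

/-- The partial quotients `aₙ` of the continued fraction expansion
`α = [a₀; a₁, a₂, …]` (as natural numbers; for irrational `α` and `n ≥ 1`
one has `cfa α n ≥ 1`). -/
noncomputable def cfa (α : ℝ) (n : ℕ) : ℕ := (⌊cfQuot α n⌋).toNat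

/-- The denominators `qₙ` of the convergents `pₙ/qₙ` of `α`:
`q₀ = 1`, `q₁ = a₁` and `q_{n+2} = a_{n+2} q_{n+1} + q_n`. -/
noncomputable def cfq (α : ℝ) : ℕ → ℕ
  | 0 => 1
  | 1 => cfa α 1
  | n + 2 => cfa α (n + 2) * cfq α (n + 1) + cfq α n

/-- The numerators `pₙ` of the convergents `pₙ/qₙ` of `α`:
`p₀ = a₀`, `p₁ = a₁ a₀ + 1` and `p_{n+2} = a_{n+2} p_{n+1} + pₙ`. -/
noncomputable def cfp (α : ℝ) : ℕ → ℤ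
  | 0 => ⌊α⌋
  | 1 => (cfa α 1 : ℤ) * ⌊α⌋ + 1
  | n + 2 => (cfa α (n + 2) : ℤ) * cfp α (n + 1) + cfp α n

/-- `ρₙ = qₙ α − pₙ`. -/
noncomputable def cfrho (α : ℝ) (n : ℕ) : ℝ := (cfq α n : ℝ) * α - (cfp α n : ℝ)

/-- `λ⁽ⁿ⁾ = |ρₙ| = ‖qₙ α‖`, the distance from `qₙ α` to the nearest integer. -/
noncomputable def cflam (α : ℝ) (n : ℕ) : ℝ := |cfrho α n|

/-- The fractional part `θₙ` of the `n`-th complete quotient of `α`. -/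
noncomputable def cfTail (α : ℝ) (n : ℕ) : ℝ := cfQuot α n - ⌊cfQuot α n⌋

theorem irrational_cfQuot {α : ℝ} (hα : Irrational α) (n : ℕ) : Irrational (cfQuot α n) := by
  induction n with
  | zero => exact hα
  | succ n ih => exact (ih.sub_intCast _).inv

theorem cfTail_pos {α : ℝ} (hα : Irrational α) (n : ℕ) : 0 < cfTail α n := by
  have h : 0 ≤ cfTail α n := Int.fract_nonneg _
  refine lt_of_le_of_ne h fun h0 => ?_
  exact ((irrational_cfQuot hα n).sub_intCast ⌊cfQuot α n⌋).ne_zero h0.symm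

theorem cfTail_lt_one (α : ℝ) (n : ℕ) : cfTail α n < 1 := Int.fract_lt_one _

theorem one_le_floor_cfQuot {α : ℝ} (hα : Irrational α) (n : ℕ) : 1 ≤ ⌊cfQuot α (n + 1)⌋ := by
  rw [Int.le_floor, Int.cast_one]
  exact (one_le_inv₀ (cfTail_pos hα n)).2 (cfTail_lt_one α n).le

theorem one_le_cfa {α : ℝ} (hα : Irrational α) (n : ℕ) : 1 ≤ cfa α (n + 1) := by
  have := one_le_floor_cfQuot hα n
  unfold cfa
  omega

theorem cfa_succ_cast {α : ℝ} (hα : Irrational α) (n : ℕ) :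
    (cfa α (n + 1) : ℝ) = (cfTail α n)⁻¹ - cfTail α (n + 1) := by
  have h := one_le_floor_cfQuot hα n
  have h2 : ((cfa α (n + 1) : ℕ) : ℤ) = ⌊cfQuot α (n + 1)⌋ := Int.toNat_of_nonneg (by omega)
  have h3 : (cfa α (n + 1) : ℝ) = (⌊cfQuot α (n + 1)⌋ : ℝ) := by exact_mod_cast h2
  have h4 : cfQuot α (n + 1) = (cfTail α n)⁻¹ := rfl
  rw [h3, ← h4, cfTail]
  ring

theorem cfq_pos {α : ℝ} (hα : Irrational α) (n : ℕ) : 0 < cfq α n := by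
  induction n using Nat.twoStepInduction with
  | zero => exact Nat.one_pos
  | one => exact one_le_cfa hα 0
  | more n ih _ => exact Nat.add_pos_right _ ih

theorem cfq_le_succ {α : ℝ} (hα : Irrational α) (n : ℕ) : cfq α n ≤ cfq α (n + 1) := by
  cases n with
  | zero => exact one_le_cfa hα 0
  | succ n =>
    have h := Nat.le_mul_of_pos_left (cfq α (n + 1)) (one_le_cfa hα (n + 1))
    exact h.trans (Nat.le_add_right _ _)

theorem cfrho_succ {α : ℝ} (hα : Irrational α) (n : ℕ) :
    cfrho α (n + 1) = -cfTail α (n + 1) * cfrho α n := by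
  induction n with
  | zero =>
    have h := (cfTail_pos hα 0).ne'
    have ha := cfa_succ_cast hα 0
    have h0 : cfTail α 0 = α - ⌊α⌋ := rfl
    simp only [cfrho, cfq, cfp, zero_add] at ha ⊢
    push_cast
    have : (cfa α 1 : ℝ) * (α - ⌊α⌋) = 1 - cfTail α 1 * (α - ⌊α⌋) := by
      rw [ha, ← h0]
      field_simp
    linarith
  | succ n ih =>
    have h := (cfTail_pos hα (n + 1)).ne'
    have hrec : cfrho α (n + 2) = cfa α (n + 2) * cfrho α (n + 1) + cfrho α n := by
      simp only [cfrho, cfq, cfp]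
      push_cast
      ring
    rw [hrec, cfa_succ_cast hα (n + 1), ih]
    field_simp
    ring

theorem cfp_mul_cfq_sub (α : ℝ) (n : ℕ) :
    cfp α (n + 1) * cfq α n - cfp α n * cfq α (n + 1) = (-1) ^ n := by
  induction n with
  | zero => simp [cfp, cfq]; ring
  | succ n ih =>
    have hp : cfp α (n + 2) = (cfa α (n + 2) : ℤ) * cfp α (n + 1) + cfp α n := rfl
    have hq : cfq α (n + 2) = cfa α (n + 2) * cfq α (n + 1) + cfq α n := rfl
    rw [hp, hq, pow_succ, ← ih]
    push_cast
    ring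

theorem cfrho_eq {α : ℝ} (hα : Irrational α) (n : ℕ) : cfrho α n = (-1) ^ n * cflam α n := by
  have key : 0 < (-1) ^ n * cfrho α n := by
    induction n with
    | zero => simpa [cfrho, cfq, cfp, cfTail, cfQuot] using cfTail_pos hα 0
    | succ n ih =>
      rw [cfrho_succ hα, pow_succ]
      have := mul_pos (cfTail_pos hα (n + 1)) ih
      linarith
  have h : cflam α n = (-1) ^ n * cfrho α n := by
    rw [← abs_of_pos key, abs_mul, abs_pow, abs_neg, abs_one, one_pow, one_mul, cflam]
  rw [h, ← mul_assoc, ← mul_pow]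
  norm_num

theorem cflam_pos {α : ℝ} (hα : Irrational α) (n : ℕ) : 0 < cflam α n := by
  induction n with
  | zero =>
    have h := cfTail_pos hα 0
    simpa [cflam, cfrho, cfq, cfp, cfTail, cfQuot] using h.ne'
  | succ n ih =>
    rw [cflam, cfrho_succ hα, abs_mul]
    exact mul_pos (abs_pos.2 (neg_ne_zero.2 (cfTail_pos hα _).ne')) ih

theorem cflam_succ_le {α : ℝ} (hα : Irrational α) (n : ℕ) : cflam α (n + 1) ≤ cflam α n := by
  rw [cflam, cfrho_succ hα, abs_mul, abs_neg, abs_of_pos (cfTail_pos hα _)]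
  exact mul_le_of_le_one_left (abs_nonneg _) (cfTail_lt_one α _).le

theorem cfq_mul_cflam_add {α : ℝ} (hα : Irrational α) (n : ℕ) :
    cfq α (n + 1) * cflam α n + cfq α n * cflam α (n + 1) = 1 := by
  have hdet : ((cfp α (n + 1) * cfq α n - cfp α n * cfq α (n + 1) : ℤ) : ℝ) = (-1) ^ n := by
    rw [cfp_mul_cfq_sub]
    push_cast
    rfl
  have h0 := cfrho_eq hα n
  have h1 := cfrho_eq hα (n + 1)
  have e : (-1 : ℝ) ^ n * (cfq α (n + 1) * cflam α n + cfq α n * cflam α (n + 1))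
      = (-1) ^ n := by
    rw [pow_succ] at h1
    simp only [cfrho] at h0 h1
    push_cast at hdet
    linear_combination hdet + (-(cfq α (n + 1) : ℝ)) * h0 + (cfq α n : ℝ) * h1
  have h2 : (-1 : ℝ) ^ n ≠ 0 := pow_ne_zero _ (by norm_num)
  exact mul_left_cancel₀ h2 (e.trans (mul_one _).symm)

theorem half_le_cfq_succ_mul_cflam {α : ℝ} (hα : Irrational α) (n : ℕ) :
    1 / 2 ≤ cfq α (n + 1) * cflam α n := by
  have h := cfq_mul_cflam_add hα n
  have hq : (cfq α n : ℝ) ≤ cfq α (n + 1) := by exact_mod_cast cfq_le_succ hα n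
  have := mul_le_mul hq (cflam_succ_le hα n) (cflam_pos hα _).le (Nat.cast_nonneg _)
  linarith

/-- Best approximation property of the convergents. -/
theorem cflam_le_abs_sub {α : ℝ} (hα : Irrational α) (n : ℕ) (j : ℤ) (hj : 0 < j)
    (hjq : j < cfq α (n + 1)) (m : ℤ) : cflam α n ≤ |j * α - m| := by
  have hdet := cfp_mul_cfq_sub α n
  have hs : ((-1 : ℤ) ^ n) * (-1) ^ n = 1 := by rw [← mul_pow]; norm_num
  obtain ⟨s, t, hjst, hmst⟩ : ∃ s t : ℤ, j = s * cfq α n + t * cfq α (n + 1) ∧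
      m = s * cfp α n + t * cfp α (n + 1) := by
    refine ⟨(-1) ^ n * (j * cfp α (n + 1) - m * cfq α (n + 1)),
      (-1) ^ n * (m * cfq α n - j * cfp α n), ?_, ?_⟩
    · linear_combination (-j) * hs - j * (-1) ^ n * hdet
    · linear_combination (-m) * hs - m * (-1) ^ n * hdet
  have hq0 : (0 : ℤ) < cfq α n := by exact_mod_cast cfq_pos hα n
  have hq1 : (0 : ℤ) < cfq α (n + 1) := by exact_mod_cast cfq_pos hα (n + 1)
  have hθ := cfTail_pos hα (n + 1)
  have e : (j : ℝ) * α - m = (s - t * cfTail α (n + 1)) * cfrho α n := by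
    have hr := cfrho_succ hα n
    have : (j : ℝ) * α - m = s * cfrho α n + t * cfrho α (n + 1) := by
      rw [hjst, hmst]
      simp only [cfrho]
      push_cast
      ring
    rw [this, hr]
    ring
  have hcoef : 1 ≤ |(s : ℝ) - t * cfTail α (n + 1)| := by
    rcases lt_trichotomy t 0 with ht | ht | ht
    · have h1 : 0 < s := by nlinarith
      have h1' : (1 : ℝ) ≤ s := by exact_mod_cast h1
      have h2' : (t : ℝ) < 0 := by exact_mod_cast ht
      exact le_abs.2 (Or.inl (by nlinarith))
    · subst ht
      have h1 : s ≠ 0 := by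
        rintro rfl
        omega
      have h2 : (1 : ℤ) ≤ |s| := Int.one_le_abs h1
      have h3 : (1 : ℝ) ≤ |(s : ℝ)| := by exact_mod_cast h2
      simpa using h3
    · have h1 : s < 0 := by nlinarith
      have h1' : (s : ℝ) ≤ -1 := by exact_mod_cast (by omega : s ≤ -1)
      have h2' : (0 : ℝ) < t := by exact_mod_cast ht
      exact le_abs.2 (Or.inr (by nlinarith))
  rw [e, abs_mul, cflam]
  exact le_mul_of_one_le_left (abs_nonneg _) hcoef

/-- For points that are `L`-separated and bounded below by `c`, the sum of `1 / (f (f + δ))` is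
controlled by a telescoping sum. -/
theorem sum_inv_mul_add_le {ι : Type*} [DecidableEq ι] (f : ι → ℝ) {L δ : ℝ} (hL : 0 < L)
    (hδ : 0 ≤ δ) (hδL : δ ≤ L) (s : Finset ι)
    (hsep : ∀ i ∈ s, ∀ j ∈ s, i ≠ j → L ≤ |f i - f j|) (c : ℝ) (hc : L / 2 < c)
    (hcs : ∀ i ∈ s, c ≤ f i) :
    ∑ i ∈ s, (f i * (f i + δ))⁻¹ ≤ (L * (c - L / 2 + δ / 2))⁻¹ := by
  induction s using Finset.induction_on_min_value f generalizing c with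
  | empty =>
    rw [Finset.sum_empty]
    exact inv_nonneg.2 (mul_nonneg hL.le (by linarith))
  | insert a s ha hmin ih =>
    rw [Finset.sum_insert ha]
    have hca := hcs a (Finset.mem_insert_self a s)
    have h1 := ih (fun i hi j hj => hsep i (Finset.mem_insert_of_mem hi) j
      (Finset.mem_insert_of_mem hj)) (f a + L) (by linarith) (fun i hi => by
        have h := hsep i (Finset.mem_insert_of_mem hi) a (Finset.mem_insert_self a s)
          (fun h => ha (h ▸ hi))
        rw [abs_of_nonneg (sub_nonneg.2 (hmin i hi))] at h
        linarith)
    have h2 : (L * (f a - L / 2 + δ / 2))⁻¹ ≤ (L * (c - L / 2 + δ / 2))⁻¹ := by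
      apply inv_anti₀ (mul_pos hL (by linarith))
      apply mul_le_mul_of_nonneg_left _ hL.le
      linarith
    have hA : 0 < f a - L / 2 + δ / 2 := by linarith
    have hB : 0 < f a + L - L / 2 + δ / 2 := by linarith
    have h3 : (f a * (f a + δ))⁻¹ ≤
        (L * (f a - L / 2 + δ / 2))⁻¹ - (L * (f a + L - L / 2 + δ / 2))⁻¹ := by
      have e : (L * (f a - L / 2 + δ / 2))⁻¹ - (L * (f a + L - L / 2 + δ / 2))⁻¹ =
          ((f a - L / 2 + δ / 2) * (f a + L - L / 2 + δ / 2))⁻¹ := by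
        rw [mul_inv, mul_inv, mul_inv, ← mul_sub, inv_sub_inv hA.ne' hB.ne']
        have hAB : f a + L - L / 2 + δ / 2 - (f a - L / 2 + δ / 2) = L := by ring
        rw [hAB, ← mul_div_assoc, inv_mul_cancel₀ hL.ne', one_div, mul_inv]
      rw [e]
      apply inv_anti₀ (mul_pos hA hB)
      nlinarith
    linarith

theorem inv_sub_inv_add {a δ : ℝ} (ha : 0 < a) (hδ : 0 ≤ δ) :
    a⁻¹ - (a + δ)⁻¹ = δ * (a * (a + δ))⁻¹ := by
  have : 0 < a + δ := by linarith
  field_simp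
  ring

theorem inv_mul_le_inv_mul_add {u L δ : ℝ} (hu : 0 < u) (hL : 0 < L) (hδ : 0 ≤ δ) :
    (L * (u + L - L / 2 + δ / 2))⁻¹ ≤ (u * (u + δ))⁻¹ + (2 * L ^ 2)⁻¹ := by
  obtain ⟨w, hw⟩ : ∃ w, w = u + δ / 2 := ⟨_, rfl⟩
  have hw0 : 0 < w := by linarith
  have h1 : (w ^ 2)⁻¹ ≤ (u * (u + δ))⁻¹ := by
    apply inv_anti₀ (by positivity)
    rw [hw]
    nlinarith [sq_nonneg δ]
  have h2 : (L * (w + L / 2))⁻¹ ≤ (w ^ 2)⁻¹ + (2 * L ^ 2)⁻¹ := by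
    have e : (w ^ 2)⁻¹ + (2 * L ^ 2)⁻¹ = (2 * L ^ 2 + w ^ 2) / (2 * L ^ 2 * w ^ 2) := by
      field_simp
    rw [e, inv_eq_one_div, div_le_div_iff₀ (by positivity) (by positivity)]
    have : 0 ≤ L * w * (w - L) ^ 2 := by positivity
    have : 0 ≤ L ^ 2 * (w - L) ^ 2 := by positivity
    have : 0 < L ^ 3 * w := by positivity
    have : 0 < L ^ 4 := by positivity
    have : 0 < L * w ^ 3 := by positivity
    nlinarith
  have e : u + L - L / 2 + δ / 2 = w + L / 2 := by rw [hw]; ring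
  rw [e]
  linarith

/-- Comparison of the sums of reciprocals along an `L`-separated configuration `X` in the circle
and its translate `Y` by `δ ≥ 0`. -/
theorem abs_sum_inv_sub_sum_inv_le (q : ℕ) (X Y : ℕ → ℝ) {L M δ : ℝ} (hL : 0 < L) (hδ : 0 ≤ δ)
    (hδM : δ ≤ M) (hML : M ≤ L) (hqL : 1 / 2 ≤ q * L)
    (hX0 : ∀ j < q, 0 < X j) (hX1 : ∀ j < q, X j < 1) (hY0 : ∀ j < q, 0 < Y j)
    (hXY : ∀ j < q, Y j = X j + δ ∨ Y j = X j + δ - 1)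
    (hsep : ∀ i < q, ∀ j < q, i ≠ j → L ≤ |X i - X j| ∧ |X i - X j| ≤ 1 - L)
    (j₀ j₁ : ℕ) (hj₀ : j₀ < q) (hj₁ : j₁ < q)
    (hmin₀ : ∀ j < q, X j₀ ≤ X j) (hmin₁ : ∀ j < q, Y j₁ ≤ Y j) :
    |(∑ j ∈ Finset.range q, (X j)⁻¹) - ∑ j ∈ Finset.range q, (Y j)⁻¹| ≤
      |(X j₀)⁻¹ - (Y j₀)⁻¹| + |(X j₁)⁻¹ - (Y j₁)⁻¹| + M * q / L := by
  rw [← Finset.sum_sub_distrib]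
  have hgap : ∀ j < q, j ≠ j₀ → X j₀ + L ≤ X j := fun j hj hne => by
    have h := (hsep j hj j₀ hj₀ hne).1
    rw [abs_of_nonneg (sub_nonneg.2 (hmin₀ j hj))] at h
    linarith
  have hu := hX0 j₀ hj₀
  have hM : δ * (2 * L ^ 2)⁻¹ ≤ M * q / L := by
    have e : M * q / L = M * (2 * (q * L)) * (2 * L ^ 2)⁻¹ := by field_simp
    rw [e]
    apply mul_le_mul_of_nonneg_right _ (by positivity)
    nlinarith
  have hM0 : 0 ≤ M * q / L := le_trans (by positivity) hM
  have hrest : ∀ s : Finset ℕ, (∀ j ∈ s, j < q ∧ j ≠ j₀ ∧ Y j = X j + δ) →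
      0 ≤ ∑ j ∈ s, ((X j)⁻¹ - (Y j)⁻¹) ∧ ∑ j ∈ s, ((X j)⁻¹ - (Y j)⁻¹) ≤
        δ * (L * (X j₀ + L - L / 2 + δ / 2))⁻¹ := by
    intro s hs
    have e : ∑ j ∈ s, ((X j)⁻¹ - (Y j)⁻¹) = δ * ∑ j ∈ s, (X j * (X j + δ))⁻¹ := by
      rw [Finset.mul_sum]
      refine Finset.sum_congr rfl fun j hj => ?_
      obtain ⟨h1, -, h2⟩ := hs j hj
      rw [h2, inv_sub_inv_add (hX0 j h1) hδ]
    rw [e]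
    constructor
    · refine mul_nonneg hδ (Finset.sum_nonneg fun j hj => ?_)
      have := hX0 j (hs j hj).1
      positivity
    · exact mul_le_mul_of_nonneg_left (sum_inv_mul_add_le X hL hδ (hδM.trans hML) s
        (fun i hi j hj hij => (hsep i (hs i hi).1 j (hs j hj).1 hij).1) _ (by linarith)
        (fun i hi => hgap i (hs i hi).1 (hs i hi).2.1)) hδ
  by_cases hjump : ∀ j < q, Y j = X j + δ
  · have hj : j₁ = j₀ := by
      by_contra hne
      have h1 := hgap j₁ hj₁ hne
      have h2 := hmin₁ j₀ hj₀
      rw [hjump j₀ hj₀, hjump j₁ hj₁] at h2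
      linarith
    subst hj
    obtain ⟨hR0, hR⟩ := hrest ((Finset.range q).erase j₁) (fun j hj => by
      rw [Finset.mem_erase, Finset.mem_range] at hj
      exact ⟨hj.2, hj.1, hjump j hj.2⟩)
    rw [← Finset.add_sum_erase _ _ (Finset.mem_range.2 hj₁)]
    have hT : (X j₁)⁻¹ - (Y j₁)⁻¹ = δ * (X j₁ * (X j₁ + δ))⁻¹ := by
      rw [hjump j₁ hj₁, inv_sub_inv_add hu hδ]
    have hT0 : 0 ≤ (X j₁)⁻¹ - (Y j₁)⁻¹ := by
      rw [hT]
      positivity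
    have hb := mul_le_mul_of_nonneg_left (inv_mul_le_inv_mul_add hu hL hδ) hδ
    rw [mul_add δ] at hb
    rw [abs_of_nonneg hT0, abs_of_nonneg (add_nonneg hT0 hR0)]
    linarith
  · push Not at hjump
    obtain ⟨k, hk, hYk⟩ := hjump
    have hYk := (hXY k hk).resolve_left hYk
    have hYk0 := hY0 k hk
    have htop : ∀ j < q, j ≠ k → X j ≤ X k - L := fun j hj hne => by
      have h := (hsep j hj k hk hne).1
      rcases le_abs.1 h with h | h
      · linarith [hX1 j hj]
      · linarith
    have hstay : ∀ j < q, j ≠ k → Y j = X j + δ := fun j hj hne =>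
      (hXY j hj).resolve_right fun h => by
        linarith [htop j hj hne, hY0 j hj, hX1 k hk]
    have hk₁ : k = j₁ := by
      by_contra hne
      have h1 := hstay j₁ hj₁ (Ne.symm hne)
      have h2 := hmin₁ k hk
      linarith [hX0 j₁ hj₁, hX1 k hk]
    subst hk₁
    rw [← Finset.add_sum_erase _ _ (Finset.mem_range.2 hk)]
    by_cases hne : j₀ = k
    · have hempty : (Finset.range q).erase k = ∅ := by
        refine Finset.eq_empty_of_forall_notMem fun j hj => ?_
        rw [Finset.mem_erase, Finset.mem_range] at hj
        have h1 := htop j hj.2 hj.1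
        have h2 := hmin₀ j hj.2
        rw [hne] at h2
        linarith
      rw [hempty, Finset.sum_empty, add_zero]
      linarith [abs_nonneg ((X j₀)⁻¹ - (Y j₀)⁻¹)]
    · have hmem : j₀ ∈ (Finset.range q).erase k :=
        Finset.mem_erase.2 ⟨hne, Finset.mem_range.2 hj₀⟩
      rw [← Finset.add_sum_erase _ _ hmem]
      have hs : ∀ j ∈ ((Finset.range q).erase k).erase j₀, j < q ∧ j ≠ j₀ ∧ Y j = X j + δ := by
        intro j hj
        simp only [Finset.mem_erase, Finset.mem_range] at hj
        exact ⟨hj.2.2, hj.1, hstay j hj.2.2 hj.2.1⟩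
      obtain ⟨hR0, hR⟩ := hrest _ hs
      have hT0 : 0 ≤ (X j₀)⁻¹ - (Y j₀)⁻¹ := by
        rw [hstay j₀ hj₀ hne, inv_sub_inv_add hu hδ]
        positivity
      rw [abs_of_nonneg hT0]
      have hwrap := (hsep j₀ hj₀ k hk hne).2
      have hRJ : ∑ j ∈ ((Finset.range q).erase k).erase j₀, ((X j)⁻¹ - (Y j)⁻¹) ≤
          2 * |(X k)⁻¹ - (Y k)⁻¹| := by
        rcases (((Finset.range q).erase k).erase j₀).eq_empty_or_nonempty with h | ⟨j, hj⟩
        · rw [h, Finset.sum_empty]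
          positivity
        · have hwrap' := (neg_le_abs (X j₀ - X k)).trans hwrap
          have hjk : j ≠ k := (Finset.mem_erase.1 (Finset.mem_erase.1 hj).2).1
          have h1 := hgap j (hs j hj).1 (hs j hj).2.1
          have h2 := htop j (hs j hj).1 hjk
          have hδ0 : 0 < δ := by linarith [hX1 k hk]
          have hYδ : δ⁻¹ ≤ (Y k)⁻¹ := inv_anti₀ hYk0 (by linarith [hX1 k hk])
          have hXδ : (X k)⁻¹ ≤ (2 * δ)⁻¹ := inv_anti₀ (by positivity) (by linarith)
          have e : (2 * δ)⁻¹ = δ⁻¹ / 2 := by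
            field_simp
          have hJ := neg_le_abs ((X k)⁻¹ - (Y k)⁻¹)
          have hL2 : δ * (L * (X j₀ + L - L / 2 + δ / 2))⁻¹ ≤ δ⁻¹ := by
            have h3 : (L * (X j₀ + L - L / 2 + δ / 2))⁻¹ ≤ (δ * δ)⁻¹ := by
              apply inv_anti₀ (by positivity)
              apply mul_le_mul <;> linarith
            calc _ ≤ δ * (δ * δ)⁻¹ := mul_le_mul_of_nonneg_left h3 hδ
              _ = δ⁻¹ := by field_simp
          linarith
      have hJ' : (X k)⁻¹ - (Y k)⁻¹ ≤ 0 := by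
        have : (X k)⁻¹ ≤ (Y k)⁻¹ := inv_anti₀ hYk0 (by linarith [abs_nonneg (X j₀ - X k)])
        linarith
      rw [abs_of_nonpos hJ'] at hRJ ⊢
      rw [abs_le]
      constructor <;> linarith

/-- The representative in `[0, 1)` of a point of the circle. -/
noncomputable def circleRep (z : UnitAddCircle) : ℝ :=
  ((AddCircle.equivIco 1 0 z : Set.Ico (0 : ℝ) (0 + 1)) : ℝ)

theorem coe_circleRep (z : UnitAddCircle) : ((circleRep z : ℝ) : UnitAddCircle) = z :=
  (AddCircle.equivIco 1 0).symm_apply_apply z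

theorem circleRep_lt_one (z : UnitAddCircle) : circleRep z < 1 :=
  (AddCircle.equivIco (1 : ℝ) 0 z).2.2.trans_eq (zero_add 1)

theorem circleRep_pos {z : UnitAddCircle} (hz : z ≠ 0) : 0 < circleRep z := by
  have h : 0 ≤ circleRep z := (AddCircle.equivIco (1 : ℝ) 0 z).2.1
  refine lt_of_le_of_ne h fun h0 => hz ?_
  rw [← coe_circleRep z, ← h0]
  rfl

theorem exists_eq_add_intCast_of_coe_eq {a b : ℝ} (h : (a : UnitAddCircle) = b) :
    ∃ m : ℤ, a = b + m := by
  rw [← sub_eq_zero, ← AddCircle.coe_sub, AddCircle.coe_eq_zero_iff] at h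
  obtain ⟨m, hm⟩ := h
  refine ⟨m, ?_⟩
  rw [zsmul_eq_mul, mul_one] at hm
  linarith

theorem circleRep_orbit_sep {α : ℝ} (hα : Irrational α) (n : ℕ) (x : UnitAddCircle)
    {i j : ℕ} (hi : i < cfq α (n + 1)) (hj : j < cfq α (n + 1)) (hij : i ≠ j) :
    cflam α n ≤ |circleRep (x + i • (α : UnitAddCircle)) -
        circleRep (x + j • (α : UnitAddCircle))| ∧
      |circleRep (x + i • (α : UnitAddCircle)) - circleRep (x + j • (α : UnitAddCircle))| ≤
        1 - cflam α n := by
  wlog hlt : j < i generalizing i j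
  · have := this hj hi hij.symm (by omega)
    rwa [abs_sub_comm] at this
  obtain ⟨d, hd⟩ : ∃ d, d = circleRep (x + i • (α : UnitAddCircle)) -
        circleRep (x + j • (α : UnitAddCircle)) := ⟨_, rfl⟩
  have hd1 : |d| < 1 := by
    have h0 : ∀ z, 0 ≤ circleRep z := fun z => (AddCircle.equivIco (1 : ℝ) 0 z).2.1
    rw [hd, abs_lt]
    constructor <;> linarith [h0 (x + i • (α : UnitAddCircle)),
      h0 (x + j • (α : UnitAddCircle)), circleRep_lt_one (x + i • (α : UnitAddCircle)),
      circleRep_lt_one (x + j • (α : UnitAddCircle))]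
  have hcoe : (d : UnitAddCircle) = (((i : ℝ) - j) * α : ℝ) := by
    have e : ((i : ℝ) - j) * α = i • α - j • α := by simp only [nsmul_eq_mul]; ring
    rw [hd, e, AddCircle.coe_sub, AddCircle.coe_sub, coe_circleRep, coe_circleRep,
      AddCircle.coe_nsmul, AddCircle.coe_nsmul]
    abel
  obtain ⟨m, hm⟩ := exists_eq_add_intCast_of_coe_eq hcoe
  have key : ∀ l : ℤ, cflam α n ≤ |d + l| := fun l => by
    have h := cflam_le_abs_sub hα n ((i : ℤ) - j) (by omega) (by omega) (-m - l)
    convert h using 2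
    rw [hm]
    push_cast
    ring
  rw [← hd]
  have h0 := key 0
  have h1 := key 1
  have h2 := key (-1)
  push_cast at h0 h1 h2
  rw [add_zero] at h0
  refine ⟨h0, ?_⟩
  rw [abs_lt] at hd1
  rw [abs_of_nonneg (by linarith)] at h1
  rw [abs_of_nonpos (by linarith)] at h2
  rcases abs_cases d with h | h <;> linarith

/-- The estimate for `y` a translate of `x` by `δ ≥ 0`. -/
theorem abs_sum_inv_circleRep_sub_le {α : ℝ} (hα : Irrational α) (n : ℕ) {δ : ℝ} (hδ : 0 ≤ δ)
    (hδM : δ ≤ cflam α (n + 1)) (x y : UnitAddCircle) (hxy : y = x + (δ : UnitAddCircle))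
    (hx : ∀ j < cfq α (n + 1), x + j • (α : UnitAddCircle) ≠ 0)
    (hy : ∀ j < cfq α (n + 1), y + j • (α : UnitAddCircle) ≠ 0)
    (j₀ j₁ : ℕ) (hj₀ : j₀ < cfq α (n + 1)) (hj₁ : j₁ < cfq α (n + 1))
    (hmax₀ : ∀ j < cfq α (n + 1), (circleRep (x + j • (α : UnitAddCircle)))⁻¹ ≤
      (circleRep (x + j₀ • (α : UnitAddCircle)))⁻¹)
    (hmax₁ : ∀ j < cfq α (n + 1), (circleRep (y + j • (α : UnitAddCircle)))⁻¹ ≤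
      (circleRep (y + j₁ • (α : UnitAddCircle)))⁻¹) :
    |(∑ j ∈ Finset.range (cfq α (n + 1)), (circleRep (x + j • (α : UnitAddCircle)))⁻¹) -
        ∑ j ∈ Finset.range (cfq α (n + 1)), (circleRep (y + j • (α : UnitAddCircle)))⁻¹| ≤
      |(circleRep (x + j₀ • (α : UnitAddCircle)))⁻¹ -
          (circleRep (y + j₀ • (α : UnitAddCircle)))⁻¹| +
        |(circleRep (x + j₁ • (α : UnitAddCircle)))⁻¹ -
          (circleRep (y + j₁ • (α : UnitAddCircle)))⁻¹| +
        cflam α (n + 1) * cfq α (n + 1) / cflam α n := by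
  have hX0 := fun j hj => circleRep_pos (hx j hj)
  have hY0 := fun j hj => circleRep_pos (hy j hj)
  have hle := cfq_mul_cflam_add hα n
  have hδ1 : δ < 1 := by
    have h1 := half_le_cfq_succ_mul_cflam hα n
    have h2 : (1 : ℝ) ≤ cfq α n := by exact_mod_cast cfq_pos hα n
    nlinarith [cflam_pos hα (n + 1)]
  refine abs_sum_inv_sub_sum_inv_le (cfq α (n + 1))
    (fun j => circleRep (x + j • (α : UnitAddCircle)))
    (fun j => circleRep (y + j • (α : UnitAddCircle))) (cflam_pos hα n) hδ hδM
    (cflam_succ_le hα n) (half_le_cfq_succ_mul_cflam hα n) hX0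
    (fun j _ => circleRep_lt_one _) hY0 (fun j hj => ?_)
    (fun i hi j hj hij => circleRep_orbit_sep hα n x hi hj hij) j₀ j₁ hj₀ hj₁
    (fun j hj => (inv_le_inv₀ (hX0 j hj) (hX0 j₀ hj₀)).1 (hmax₀ j hj))
    (fun j hj => (inv_le_inv₀ (hY0 j hj) (hY0 j₁ hj₁)).1 (hmax₁ j hj))
  have hcoe : ((circleRep (y + j • (α : UnitAddCircle)) : ℝ) : UnitAddCircle) =
      ((circleRep (x + j • (α : UnitAddCircle)) + δ : ℝ) : UnitAddCircle) := by
    rw [AddCircle.coe_add, coe_circleRep, coe_circleRep, hxy]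
    abel
  obtain ⟨m, hm⟩ := exists_eq_add_intCast_of_coe_eq hcoe
  have h1 := hX0 j hj
  have h2 := circleRep_lt_one (x + j • (α : UnitAddCircle))
  have h3 := hY0 j hj
  have h4 := circleRep_lt_one (y + j • (α : UnitAddCircle))
  have hm1 : m < 1 := by
    have : (m : ℝ) < 1 := by linarith
    exact_mod_cast this
  have hm2 : -2 < m := by
    have : (-2 : ℝ) < m := by linarith
    exact_mod_cast this
  obtain rfl | rfl : m = 0 ∨ m = -1 := by omega
  · left
    simpa using hm
  · right
    rw [hm]
    push_cast
    ring

/-- Let `α` be irrational, `n ≥ 1`, and `x, y ∈ T` with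
`‖x − y‖ ≤ λ⁽ⁿ⁾` and `x + jα ≠ 0`, `y + jα ≠ 0` for all `0 ≤ j < qₙ`.
Let `ψ₁(z) = (representative of z in [0,1))⁻¹`, and let `j₀, j₁ < qₙ`
maximize `j ↦ ψ₁(x + jα)` resp. `j ↦ ψ₁(y + jα)`.  Then
`|Σ_{j<qₙ} ψ₁(x+jα) − Σ_{j<qₙ} ψ₁(y+jα)|
  ≤ |ψ₁(x+j₀α) − ψ₁(y+j₀α)| + |ψ₁(x+j₁α) − ψ₁(y+j₁α)| + λ⁽ⁿ⁾ qₙ / λ⁽ⁿ⁻¹⁾`. -/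
theorem stmt_4 (α : ℝ) (hα : Irrational α) (n : ℕ) (hn : 1 ≤ n)
    (ψ₁ : UnitAddCircle → ℝ)
    (hψ₁ : ∀ z : UnitAddCircle,
      ψ₁ z = ((AddCircle.equivIco 1 0 z : Set.Ico (0 : ℝ) (0 + 1)) : ℝ)⁻¹)
    (x y : UnitAddCircle) (hxy : ‖x - y‖ ≤ cflam α n)
    (hx : ∀ j < cfq α n, x + j • (α : UnitAddCircle) ≠ 0)
    (hy : ∀ j < cfq α n, y + j • (α : UnitAddCircle) ≠ 0)
    (j₀ j₁ : ℕ) (hj₀ : j₀ < cfq α n) (hj₁ : j₁ < cfq α n)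
    (hmax₀ : ∀ j < cfq α n,
      ψ₁ (x + j • (α : UnitAddCircle)) ≤ ψ₁ (x + j₀ • (α : UnitAddCircle)))
    (hmax₁ : ∀ j < cfq α n,
      ψ₁ (y + j • (α : UnitAddCircle)) ≤ ψ₁ (y + j₁ • (α : UnitAddCircle))) :
    |(∑ j ∈ Finset.range (cfq α n), ψ₁ (x + j • (α : UnitAddCircle))) -
        ∑ j ∈ Finset.range (cfq α n), ψ₁ (y + j • (α : UnitAddCircle))| ≤
      |ψ₁ (x + j₀ • (α : UnitAddCircle)) - ψ₁ (y + j₀ • (α : UnitAddCircle))| +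
        |ψ₁ (x + j₁ • (α : UnitAddCircle)) - ψ₁ (y + j₁ • (α : UnitAddCircle))| +
        cflam α n * cfq α n / cflam α (n - 1) := by

  obtain ⟨n, rfl⟩ : ∃ k, n = k + 1 := ⟨n - 1, by omega⟩
  simp only [hψ₁] at hmax₀ hmax₁ ⊢
  rw [Nat.add_sub_cancel]
  obtain ⟨v, hv⟩ : ∃ v : ℝ, (v : UnitAddCircle) = x - y := ⟨_, coe_circleRep _⟩
  rw [← hv, UnitAddCircle.norm_eq] at hxy
  have hround : ((v - round v : ℝ) : UnitAddCircle) = x - y := by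
    rw [← hv, AddCircle.coe_sub]
    have : (((round v : ℤ) : ℝ) : UnitAddCircle) = 0 :=
      (AddCircle.coe_eq_zero_iff 1).2 ⟨round v, by simp⟩
    rw [this, sub_zero]
  rcases le_total 0 (v - round v) with h | h
  · rw [abs_of_nonneg h] at hxy
    have key := abs_sum_inv_circleRep_sub_le hα n h hxy y x (by rw [hround]; abel) hy hx j₁ j₀
      hj₁ hj₀ hmax₁ hmax₀
    rw [abs_sub_comm, abs_sub_comm (circleRep (y + j₁ • (α : UnitAddCircle)))⁻¹,
      abs_sub_comm (circleRep (y + j₀ • (α : UnitAddCircle)))⁻¹, add_comm |_| |_|] at key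
    exact key
  · rw [abs_of_nonpos h] at hxy
    exact abs_sum_inv_circleRep_sub_le hα n (neg_nonneg.2 h) hxy x y
      (by rw [AddCircle.coe_neg, hround]; abel) hx hy j₀ j₁ hj₀ hj₁ hmax₀ hmax₁
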